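/- arXiv:2411.11485 — 3 statements merged into one kernel-verified Lean document; each statement's English description precedes it below -/
import Mathlib

section
/- Let f ∈ F⁺_sc and let ρ be an N-partite mixed state (positive semidefinite, trace 1) on a finite-dimensional H_1⊗…⊗H_N. Then E^f_GME(ρ) = 0 if and only if ρ is biseparable, and likewise G^f_GME(ρ) = 0 if and only if ρ is biseparable. -/
open scoped BigOperators
open Matrix
open scoped ComplexOrder

/-- A symmetric concave function on finite probability vectors, invariant under
appending zero entries: the class `F_sc` of \cite{HZ,SD}. -/
structure SymmConcave where
  f : ∀ n : ℕ, (Fin n → ℝ) → ℝ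
  symm : ∀ (n : ℕ) (π : Equiv.Perm (Fin n)) (p : Fin n → ℝ), f n (p ∘ π) = f n p
  concave : ∀ n : ℕ,
    ConcaveOn ℝ {p : Fin n → ℝ | (∀ i, 0 ≤ p i) ∧ ∑ i, p i = 1} (f n)
  zeroPad : ∀ (n : ℕ) (p : Fin n → ℝ), f (n + 1) (Fin.snoc p 0) = f n p

/-- The class `F⁺_sc`: in addition, on probability vectors, `f p = 0` iff some
entry of `p` equals `1`. -/
def SymmConcave.IsPos (F : SymmConcave) : Prop :=
  ∀ (n : ℕ) (p : Fin n → ℝ), (∀ i, 0 ≤ p i) → ∑ i, p i = 1 →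
    (F.f n p = 0 ↔ ∃ i, p i = 1)

/-- Combine an assignment of indices on `γ` and one on `γᶜ` into a global index. -/
def mergeIdx {N : ℕ} {dims : Fin N → ℕ} (γ : Finset (Fin N))
    (a : ∀ i : {i // i ∈ γ}, Fin (dims i.1))
    (b : ∀ i : {i // i ∈ γᶜ}, Fin (dims i.1)) : ∀ i, Fin (dims i) := fun i =>
  if h : i ∈ γ then a ⟨i, h⟩ else b ⟨i, Finset.mem_compl.mpr h⟩

/-- The reduced density matrix of the pure state `ψ` on the parties in `γ`
(the parties in `γᶜ` are traced out). -/
noncomputable def reducedMat {N : ℕ} {dims : Fin N → ℕ} (γ : Finset (Fin N))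
    (ψ : (∀ i, Fin (dims i)) → ℂ) :
    Matrix (∀ i : {i // i ∈ γ}, Fin (dims i.1)) (∀ i : {i // i ∈ γ}, Fin (dims i.1)) ℂ :=
  Matrix.of fun a a' => ∑ b : ∀ i : {i // i ∈ γᶜ}, Fin (dims i.1),
    ψ (mergeIdx γ a b) * star (ψ (mergeIdx γ a' b))

open scoped Classical in
/-- `f` evaluated on the Schmidt vector of `ψ` across the bipartition `γ|γᶜ`
(i.e. on the eigenvalues of the reduced density matrix on `γ`). -/
noncomputable def schmidtVal {N : ℕ} {dims : Fin N → ℕ} (F : SymmConcave)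
    (γ : Finset (Fin N)) (ψ : (∀ i, Fin (dims i)) → ℂ) : ℝ :=
  if h : (reducedMat γ ψ).IsHermitian then
    F.f (Fintype.card (∀ i : {i // i ∈ γ}, Fin (dims i.1)))
      (fun k => h.eigenvalues ((Fintype.equivFin _).symm k))
  else 0

/-- All nonempty proper subsets of the parties.  Each bipartition `γ|γ̄` occurs
here as both `γ` and `γ̄`, with equal associated Schmidt values. -/
def bips (N : ℕ) : Finset (Finset (Fin N)) :=
  Finset.univ.filter fun γ => γ.Nonempty ∧ γ ≠ Finset.univ

/-- min-GME measure of a pure state: minimum of `f` of the Schmidt vector over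
all bipartitions. -/
noncomputable def EGMEp {N : ℕ} {dims : Fin N → ℕ} (F : SymmConcave)
    (ψ : (∀ i, Fin (dims i)) → ℂ) : ℝ :=
  sInf {x | ∃ γ ∈ bips N, x = schmidtVal F γ ψ}

/-- geo-GME measure of a pure state: geometric mean of `f` of the Schmidt
vectors over all bipartitions. -/
noncomputable def GGMEp {N : ℕ} {dims : Fin N → ℕ} (F : SymmConcave)
    (ψ : (∀ i, Fin (dims i)) → ℂ) : ℝ :=
  (∏ γ ∈ bips N, schmidtVal F γ ψ) ^ (((bips N).card : ℝ))⁻¹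

/-- Convex roof extension of a pure-state functional `E` to mixed states:
the infimum of `∑_k p_k E(ψ_k)` over all finite decompositions
`ρ = ∑_k p_k |ψ_k⟩⟨ψ_k|` into pure (unit-vector) states with `p_k > 0`. -/
noncomputable def convexRoof {ι : Type*} [Fintype ι] (E : (ι → ℂ) → ℝ)
    (ρ : Matrix ι ι ℂ) : ℝ :=
  sInf {x | ∃ (K : ℕ) (p : Fin K → ℝ) (ψ : Fin K → ι → ℂ),
    (∀ k, 0 < p k) ∧ (∀ k, ∑ t, ‖ψ k t‖ ^ 2 = 1) ∧
    ρ = ∑ k, (Matrix.of fun t s => ((p k : ℂ)) * (ψ k t * star (ψ k s)) : Matrix ι ι ℂ) ∧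
    x = ∑ k, p k * E (ψ k)}

/-- A pure state is biseparable if it factorizes across some bipartition. -/
def PureBisep {N : ℕ} {dims : Fin N → ℕ} (ψ : (∀ i, Fin (dims i)) → ℂ) : Prop :=
  ∃ γ ∈ bips N, ∃ (φ : (∀ i : {i // i ∈ γ}, Fin (dims i.1)) → ℂ)
    (χ : (∀ i : {i // i ∈ γᶜ}, Fin (dims i.1)) → ℂ),
    ∀ a b, ψ (mergeIdx γ a b) = φ a * χ b

/-- A mixed state is biseparable if it is a finite convex combination of
biseparable pure states. -/
def MixedBisep {N : ℕ} {dims : Fin N → ℕ}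
    (ρ : Matrix (∀ i, Fin (dims i)) (∀ i, Fin (dims i)) ℂ) : Prop :=
  ∃ (K : ℕ) (q : Fin K → ℝ) (ψ : Fin K → (∀ i, Fin (dims i)) → ℂ),
    (∀ k, 0 ≤ q k) ∧ (∑ k, q k = 1) ∧ (∀ k, ∑ t, ‖ψ k t‖ ^ 2 = 1) ∧
    (∀ k, PureBisep (ψ k)) ∧
    ρ = ∑ k, (Matrix.of fun t s => ((q k : ℂ)) * (ψ k t * star (ψ k s)) :
      Matrix (∀ i, Fin (dims i)) (∀ i, Fin (dims i)) ℂ)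

section ConvexRoof

open Set

/-- In a finite-dimensional space, the convex hull of a compact set is compact. -/
theorem IsCompact.convexHull_of_finiteDimensional {E : Type*} [NormedAddCommGroup E]
    [NormedSpace ℝ E] [FiniteDimensional ℝ E] {s : Set E} (hs : IsCompact s) :
    IsCompact (convexHull ℝ s) := by
  classical
  rcases s.eq_empty_or_nonempty with rfl | ⟨x₀, hx₀⟩
  · simp
  set n := Module.finrank ℝ E + 1
  have key : convexHull ℝ s =
      (fun x : (Fin n → ℝ) × (Fin n → E) => ∑ i, x.1 i • x.2 i) ''
        (stdSimplex ℝ (Fin n) ×ˢ Set.pi univ fun _ => s) := by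
    apply Subset.antisymm
    · intro x hx
      obtain ⟨κ, _, z, w, hz, hind, hw, hw1, hx⟩ := eq_pos_convex_span_of_mem_convexHull hx
      have hcard : Fintype.card κ ≤ Fintype.card (Fin n) := by
        have h1 := hind.card_le_finrank_succ
        have h2 := Submodule.finrank_le (vectorSpan ℝ (range z))
        simp only [Fintype.card_fin, n]
        omega
      obtain ⟨e⟩ := Function.Embedding.nonempty_of_card_le hcard
      refine ⟨(Function.extend e w 0, Function.extend e z fun _ => x₀), ⟨⟨?_, ?_⟩, ?_⟩, ?_⟩
      · intro i
        by_cases hi : ∃ j, e j = i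
        · obtain ⟨j, rfl⟩ := hi
          simpa [e.injective.extend_apply] using (hw j).le
        · simp [Function.extend_apply' _ _ _ hi]
      · rw [← hw1]
        refine (Fintype.sum_of_injective e e.injective _ _ ?_ ?_).symm
        · intro i hi
          simp [Function.extend_apply' w (0 : Fin n → ℝ) i (by simpa using hi)]
        · intro i
          simp [e.injective.extend_apply]
      · intro i _
        by_cases hi : ∃ j, e j = i
        · obtain ⟨j, rfl⟩ := hi
          simpa [e.injective.extend_apply] using hz (mem_range_self j)
        · simpa [Function.extend_apply' _ _ _ hi] using hx₀
      · rw [← hx]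
        refine (Fintype.sum_of_injective e e.injective _ _ ?_ ?_).symm
        · intro i hi
          simp [Function.extend_apply' w (0 : Fin n → ℝ) i (by simpa using hi)]
        · intro i
          simp [e.injective.extend_apply]
    · rintro _ ⟨⟨w, z⟩, ⟨hw, hz⟩, rfl⟩
      exact mem_convexHull_of_exists_fintype w z hw.1 hw.2 (fun i => hz i (mem_univ i)) rfl
  rw [key]
  exact ((isCompact_stdSimplex ℝ (Fin n)).prod (isCompact_univ_pi fun _ => hs)).image
    (by fun_prop)

/-- The indices carrying a nonzero weight, enumerated by some `Fin K`. -/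
theorem exists_enum_pos_weights {α : Type*} [Fintype α] (q : α → ℝ) (hq : ∀ a, 0 ≤ q a) :
    ∃ (K : ℕ) (e : Fin K → α), (∀ k, 0 < q (e k)) ∧
      ∀ (M : Type) [AddCommMonoid M] (g : α → M), (∀ a, q a = 0 → g a = 0) →
        ∑ k, g (e k) = ∑ a, g a := by
  classical
  let e := (Fintype.equivFin {a // q a ≠ 0}).symm
  refine ⟨_, fun k => e k, fun k => (hq _).lt_of_ne' (e k).2, fun M _ g hg => ?_⟩
  refine Fintype.sum_of_injective (fun k => (e k : α))
    (Subtype.val_injective.comp e.injective) _ _ ?_ fun _ => rfl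
  intro a ha
  refine hg a ?_
  by_contra h
  exact ha ⟨e.symm ⟨a, h⟩, by simp⟩

/-- The entries of the rank-one operator `|ψ⟩⟨ψ|`. -/
def rankOne {ι : Type*} (ψ : ι → ℂ) : ι → ι → ℂ := fun t s => ψ t * star (ψ s)

theorem continuous_rankOne {ι : Type*} : Continuous (rankOne : (ι → ℂ) → ι → ι → ℂ) := by
  unfold rankOne
  fun_prop

variable {ι : Type*} [Fintype ι]

/-- The set of pure states, i.e. of unit vectors. -/
def pureStates (ι : Type*) [Fintype ι] : Set (ι → ℂ) := {ψ | ∑ t, ‖ψ t‖ ^ 2 = 1}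

theorem isCompact_pureStates : IsCompact (pureStates ι) := by
  refine Metric.isCompact_of_isClosed_isBounded
    (isClosed_eq (by fun_prop) continuous_const) ?_
  refine isBounded_iff_forall_norm_le.mpr ⟨1, fun ψ hψ => ?_⟩
  refine (pi_norm_le_iff_of_nonneg zero_le_one).mpr fun t => ?_
  have h : ‖ψ t‖ ^ 2 ≤ 1 := by
    rw [← (show ∑ t, ‖ψ t‖ ^ 2 = 1 from hψ)]
    exact Finset.single_le_sum (f := fun t => ‖ψ t‖ ^ 2) (fun _ _ => by positivity)
      (Finset.mem_univ t)
  exact (sq_le_one_iff₀ (norm_nonneg _)).mp h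

theorem trace_of_decomposition {κ : Type*} [Fintype κ] {ρ : Matrix ι ι ℂ} {p : κ → ℝ}
    {ψ : κ → ι → ℂ} (hψ : ∀ k, ∑ t, ‖ψ k t‖ ^ 2 = 1)
    (hρ : ∀ t s, ρ t s = ∑ k, (p k : ℂ) * (ψ k t * star (ψ k s))) :
    ρ.trace = ((∑ k, p k : ℝ) : ℂ) := by
  simp only [Matrix.trace, Matrix.diag_apply, hρ]
  rw [Finset.sum_comm]
  push_cast
  refine Finset.sum_congr rfl fun k _ => ?_
  have h : ((∑ t, ‖ψ k t‖ ^ 2 : ℝ) : ℂ) = 1 := by rw [hψ k]; simp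
  rw [← Finset.mul_sum]
  push_cast at h
  simp only [RCLike.star_def, Complex.mul_conj']
  rw [h, mul_one]

theorem exists_spectral_decomposition {ρ : Matrix ι ι ℂ} (hρ : ρ.PosSemidef) :
    ∃ (p : ι → ℝ) (ψ : ι → ι → ℂ), (∀ k, 0 ≤ p k) ∧ (∀ k, ∑ t, ‖ψ k t‖ ^ 2 = 1) ∧
      ∀ t s, ρ t s = ∑ k, (p k : ℂ) * (ψ k t * star (ψ k s)) := by
  classical
  refine ⟨hρ.1.eigenvalues, fun k => hρ.1.eigenvectorBasis k, hρ.eigenvalues_nonneg,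
    fun k => ?_, fun t s => ?_⟩
  · rw [← EuclideanSpace.norm_sq_eq, hρ.1.eigenvectorBasis.norm_eq_one, one_pow]
  · conv_lhs => rw [hρ.1.spectral_theorem]
    rw [Unitary.conjStarAlgAut_apply, Matrix.mul_apply]
    refine Finset.sum_congr rfl fun k _ => ?_
    rw [Matrix.mul_diagonal, Matrix.star_apply]
    simp only [Matrix.IsHermitian.eigenvectorUnitary_apply, Function.comp_apply]
    simp only [Complex.coe_algebraMap]
    ring

/-- The convex roof of a functional that is nonnegative on pure states, vanishes on a closed set
`B`, and is bounded away from zero on every compact set of pure states avoiding `B`, vanishes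
exactly on the mixtures of pure states from `B`. -/
theorem convexRoof_eq_zero_iff {B : Set (ι → ℂ)} (hB : IsClosed B) {E : (ι → ℂ) → ℝ}
    (hE : ∀ ψ ∈ pureStates ι, 0 ≤ E ψ) (hEB : ∀ ψ ∈ pureStates ι ∩ B, E ψ = 0)
    (hEpos : ∀ T : Set (ι → ℂ), IsCompact T → T ⊆ pureStates ι \ B →
      ∃ m > 0, ∀ ψ ∈ T, m ≤ E ψ)
    {ρ : Matrix ι ι ℂ} (hρ : ρ.PosSemidef) (htr : ρ.trace = 1) :
    convexRoof E ρ = 0 ↔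
      ∃ (K : ℕ) (q : Fin K → ℝ) (ψ : Fin K → ι → ℂ),
        (∀ k, 0 ≤ q k) ∧ (∑ k, q k = 1) ∧ (∀ k, ∑ t, ‖ψ k t‖ ^ 2 = 1) ∧ (∀ k, ψ k ∈ B) ∧
        ρ = ∑ k, (Matrix.of fun t s => ((q k : ℂ)) * (ψ k t * star (ψ k s)) :
          Matrix ι ι ℂ) := by
  have hentry : ∀ {K : ℕ} {p : Fin K → ℝ} {ψ : Fin K → ι → ℂ},
      ρ = ∑ k, (Matrix.of fun t s => ((p k : ℂ)) * (ψ k t * star (ψ k s)) : Matrix ι ι ℂ) ↔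
        ∀ t s, ρ t s = ∑ k, (p k : ℂ) * (ψ k t * star (ψ k s)) := by
    intro K p ψ
    rw [← Matrix.ext_iff]
    simp only [Matrix.sum_apply, Matrix.of_apply]
  unfold convexRoof
  simp only [hentry]
  set S := {x : ℝ | ∃ (K : ℕ) (p : Fin K → ℝ) (ψ : Fin K → ι → ℂ),
    (∀ k, 0 < p k) ∧ (∀ k, ∑ t, ‖ψ k t‖ ^ 2 = 1) ∧
    (∀ t s, ρ t s = ∑ k, (p k : ℂ) * (ψ k t * star (ψ k s))) ∧
    x = ∑ k, p k * E (ψ k)} with hS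
  have hS0 : ∀ x ∈ S, 0 ≤ x := by
    rintro x ⟨K, p, ψ, hp, hψ, -, rfl⟩
    exact Finset.sum_nonneg fun k _ => mul_nonneg (hp k).le (hE _ (hψ k))
  have hSmem : ∀ {κ : Type _} [Fintype κ] (p : κ → ℝ) (ψ : κ → ι → ℂ), (∀ k, 0 ≤ p k) →
      (∀ k, ∑ t, ‖ψ k t‖ ^ 2 = 1) →
      (∀ t s, ρ t s = ∑ k, (p k : ℂ) * (ψ k t * star (ψ k s))) → ∑ k, p k * E (ψ k) ∈ S := by
    intro κ _ p ψ hp hψ hd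
    obtain ⟨K, e, he, hsum⟩ := exists_enum_pos_weights p hp
    refine ⟨K, p ∘ e, ψ ∘ e, he, fun k => hψ _, fun t s => ?_, ?_⟩
    · rw [hd, ← hsum ℂ _ fun a ha => by simp [ha]]
      rfl
    · rw [← hsum ℝ _ fun a ha => by simp [ha]]
      rfl
  constructor
  · intro h0
    have hne : S.Nonempty := by
      obtain ⟨p, ψ, hp, hψ, hd⟩ := exists_spectral_decomposition hρ
      obtain ⟨K, e, he, hsum⟩ := exists_enum_pos_weights p hp
      refine ⟨_, K, p ∘ e, ψ ∘ e, he, fun k => hψ _, fun t s => ?_, rfl⟩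
      rw [hd, ← hsum ℂ _ fun a ha => by simp [ha]]
      rfl
    set C := rankOne '' (pureStates ι ∩ B)
    have hC : IsCompact (convexHull ℝ C) :=
      ((isCompact_pureStates.inter_right hB).image
        continuous_rankOne).convexHull_of_finiteDimensional
    by_cases hmem : (fun t s => ρ t s) ∈ convexHull ℝ C
    · rw [mem_convexHull_iff_exists_fintype] at hmem
      obtain ⟨κ, _, w, z, hw, hw1, hz, hsum⟩ := hmem
      choose ψ hψ hψz using hz
      obtain ⟨K, e, he, hsum'⟩ := exists_enum_pos_weights w hw
      refine ⟨K, w ∘ e, ψ ∘ e, fun k => (he k).le, ?_, fun k => (hψ _).1, fun k => (hψ _).2,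
        fun t s => ?_⟩
      · rw [← hw1, ← hsum' ℝ w fun _ h => h]
        rfl
      · have h1 := congrFun (congrFun hsum t) s
        rw [← h1]
        simp only [Finset.sum_apply, Pi.smul_apply, Complex.real_smul, ← hψz]
        rw [← hsum' ℂ _ fun a ha => by simp [ha]]
        rfl
    · exfalso
      obtain ⟨L, c, hLρ, hLC⟩ :=
        geometric_hahn_banach_point_closed (convex_convexHull ℝ C) hC.isClosed hmem
      have hcont : Continuous fun ψ : ι → ℂ => L (rankOne ψ) := L.continuous.comp continuous_rankOne
      obtain ⟨m, hm, hmE⟩ := hEpos (pureStates ι ∩ {ψ | L (rankOne ψ) ≤ c})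
        (isCompact_pureStates.inter_right (isClosed_le hcont continuous_const)) fun ψ hψ =>
          ⟨hψ.1, fun hψB => absurd (hLC _ (subset_convexHull ℝ C ⟨ψ, ⟨hψ.1, hψB⟩, rfl⟩))
            (not_lt.mpr hψ.2)⟩
      obtain ⟨A, hA⟩ := (isCompact_pureStates (ι := ι)).exists_bound_of_continuousOn
        (f := fun ψ => c - L (rankOne ψ)) (continuous_const.sub hcont).continuousOn
      set M := max A 1
      have hM : 0 < M := lt_max_of_lt_right one_pos
      have hbound : ∀ ψ ∈ pureStates ι, m / M * (c - L (rankOne ψ)) ≤ E ψ := by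
        intro ψ hψ
        by_cases hle : L (rankOne ψ) ≤ c
        · refine le_trans ?_ (hmE ψ ⟨hψ, hle⟩)
          rw [div_mul_eq_mul_div, div_le_iff₀ hM]
          have h1 := (le_abs_self _).trans ((hA ψ hψ).trans (le_max_left A 1))
          exact mul_le_mul_of_nonneg_left h1 hm.le
        · refine le_trans ?_ (hE ψ hψ)
          exact mul_nonpos_of_nonneg_of_nonpos (by positivity) (by linarith [not_le.mp hle])
      set δ := m / M * (c - L fun t s => ρ t s)
      have hδ : 0 < δ := mul_pos (by positivity) (by linarith)
      have hlow : δ ≤ sInf S := by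
        refine le_csInf hne ?_
        rintro x ⟨K, p, ψ, hp, hψ, hd, rfl⟩
        have hp1 : ∑ k, p k = 1 := by
          have := trace_of_decomposition hψ hd
          rw [htr] at this
          exact_mod_cast this.symm
        have hρL : (fun t s => ρ t s) = ∑ k, p k • rankOne (ψ k) := by
          ext t s
          simp [hd, Finset.sum_apply, rankOne]
        calc δ = ∑ k, p k * (m / M * (c - L (rankOne (ψ k)))) := by
              simp only [δ, hρL, map_sum, map_smul, smul_eq_mul]
              have : ∀ k, p k * (m / M * (c - L (rankOne (ψ k)))) =
                  m / M * (p k * c - p k * L (rankOne (ψ k))) := fun k => by ring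
              simp only [this, ← Finset.mul_sum, Finset.sum_sub_distrib, ← Finset.sum_mul, hp1,
                one_mul]
          _ ≤ ∑ k, p k * E (ψ k) :=
              Finset.sum_le_sum fun k _ => mul_le_mul_of_nonneg_left (hbound _ (hψ k)) (hp k).le
      linarith
  · rintro ⟨K, q, ψ, hq, -, hψ, hψB, hd⟩
    refine le_antisymm (csInf_le ⟨0, hS0⟩ ?_) (Real.sInf_nonneg hS0)
    have h0 := hSmem q ψ hq hψ hd
    rwa [Finset.sum_eq_zero fun k _ => by rw [hEB _ ⟨hψ k, hψB k⟩, mul_zero]] at h0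

end ConvexRoof

section Schmidt

theorem exists_pos_forall_le {α : Type*} [Finite α] {g : α → ℝ} (hg : ∀ i, 0 < g i) :
    ∃ c > 0, ∀ i, c ≤ g i := by
  have h : ∀ᶠ c in nhdsWithin (0 : ℝ) (Set.Ioi 0), ∀ i, c ≤ g i :=
    Filter.eventually_all.mpr fun i =>
      Filter.Eventually.filter_mono nhdsWithin_le_nhds (eventually_le_nhds (hg i))
  obtain ⟨c, hc, hc0⟩ := (h.and self_mem_nhdsWithin).exists
  exact ⟨c, hc0, hc⟩

/-- A function of class `F⁺_sc` dominates a multiple of the linear entropy. -/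
theorem SymmConcave.IsPos.exists_mul_le {F : SymmConcave} (hF : F.IsPos) (n : ℕ) :
    ∃ c > 0, ∀ p : Fin n → ℝ, (∀ i, 0 ≤ p i) → ∑ i, p i = 1 →
      c * (1 - ∑ i, p i ^ 2) ≤ F.f n p := by
  classical
  let e : Fin n → Fin n → ℝ := fun i => Pi.single i 1
  let v : Fin n × Fin n → Fin n → ℝ := fun x => (1 / 2 : ℝ) • e x.1 + (1 / 2 : ℝ) • e x.2
  have he : ∀ i, e i ∈ {p : Fin n → ℝ | (∀ i, 0 ≤ p i) ∧ ∑ i, p i = 1} := fun i =>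
    ⟨fun j => by simp only [e, Pi.single_apply]; split_ifs <;> simp, by simp [e]⟩
  have he0 : ∀ i, F.f n (e i) = 0 := fun i =>
    (hF n _ (he i).1 (he i).2).mpr ⟨i, by simp [e]⟩
  have hv : ∀ x, v x ∈ {p : Fin n → ℝ | (∀ i, 0 ≤ p i) ∧ ∑ i, p i = 1} := fun x =>
    (F.concave n).1 (he x.1) (he x.2) (by norm_num) (by norm_num) (by norm_num)
  have hv0 : ∀ x, 0 ≤ F.f n (v x) := by
    intro x
    have := (F.concave n).2 (he x.1) (he x.2)
      (show (0 : ℝ) ≤ 1 / 2 by norm_num) (show (0 : ℝ) ≤ 1 / 2 by norm_num) (by norm_num)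
    simpa only [he0, smul_zero, add_zero] using this
  have hvpos : ∀ x : Fin n × Fin n, x.1 ≠ x.2 → 0 < F.f n (v x) := by
    intro x hx
    refine (hv0 x).lt_of_ne' fun h => ?_
    obtain ⟨i, hi⟩ := (hF n _ (hv x).1 (hv x).2).mp h
    simp only [v, e, Pi.add_apply, Pi.smul_apply, Pi.single_apply, smul_eq_mul] at hi
    split_ifs at hi with h1 h2
    · exact hx (h1.symm.trans h2)
    all_goals norm_num at hi
  obtain ⟨c, hc, hcv⟩ := exists_pos_forall_le (α := {x : Fin n × Fin n // x.1 ≠ x.2})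
    (g := fun x => F.f n (v x)) fun x => hvpos x x.2
  refine ⟨c, hc, fun p hp hp1 => ?_⟩
  have hsum : ∑ x : Fin n × Fin n, p x.1 * p x.2 = 1 := by
    rw [Fintype.sum_prod_type, ← Fintype.sum_mul_sum, hp1, one_mul]
  have hmix : ∑ x : Fin n × Fin n, (p x.1 * p x.2) • v x = p := by
    ext k
    have hk : ∑ i, p i * e i k = p k := by simp [e, Pi.single_apply]
    simp only [Finset.sum_apply, Pi.smul_apply, v, Pi.add_apply, smul_eq_mul,
      Fintype.sum_prod_type]
    have h1 : ∀ i j, p i * p j * (1 / 2 * e i k + 1 / 2 * e j k) =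
        1 / 2 * ((p i * e i k) * p j) + 1 / 2 * (p i * (p j * e j k)) := fun i j => by ring
    simp only [h1, Finset.sum_add_distrib, ← Finset.mul_sum, ← Finset.sum_mul, hp1, hk]
    ring
  have hJ := (F.concave n).le_map_sum (t := Finset.univ)
    (w := fun x : Fin n × Fin n => p x.1 * p x.2) (p := v)
    (fun x _ => mul_nonneg (hp _) (hp _)) hsum (fun x _ => hv x)
  rw [hmix] at hJ
  refine le_trans ?_ hJ
  have hlin : c * (1 - ∑ i, p i ^ 2) = ∑ x : Fin n × Fin n,
      (p x.1 * p x.2) * (if x.1 = x.2 then 0 else c) := by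
    have h1 : ∀ x : Fin n × Fin n, (p x.1 * p x.2) * (if x.1 = x.2 then 0 else c) =
        c * (p x.1 * p x.2) - c * (if x.1 = x.2 then p x.1 * p x.2 else 0) := fun x => by
      split_ifs <;> ring
    simp only [h1, Finset.sum_sub_distrib, ← Finset.mul_sum, hsum]
    simp [Fintype.sum_prod_type, sq, mul_sub]
  rw [hlin]
  refine Finset.sum_le_sum fun x _ => mul_le_mul_of_nonneg_left ?_ (mul_nonneg (hp _) (hp _))
  split_ifs with h
  · exact hv0 x
  · exact hcv ⟨x, h⟩

theorem SymmConcave.IsPos.eq_zero {F : SymmConcave} (hF : F.IsPos) {n : ℕ} {p : Fin n → ℝ}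
    (hp : ∀ i, 0 ≤ p i) (hp1 : ∑ i, p i = 1) (hsq : ∑ i, p i ^ 2 = 1) : F.f n p = 0 := by
  refine (hF n p hp hp1).mpr ?_
  have hle : ∀ i, p i ≤ 1 := fun i => by
    rw [← hp1]
    exact Finset.single_le_sum (fun i _ => hp i) (Finset.mem_univ i)
  have h0 : ∑ i, p i * (1 - p i) = 0 := by
    simp only [mul_sub, mul_one, ← sq, Finset.sum_sub_distrib, hp1, hsq, sub_self]
  rw [Finset.sum_eq_zero_iff_of_nonneg
    fun i _ => mul_nonneg (hp i) (sub_nonneg.mpr (hle i))] at h0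
  by_contra! h
  refine zero_ne_one ((Finset.sum_eq_zero fun i _ => ?_).symm.trans hp1)
  exact (mul_eq_zero.mp (h0 i (Finset.mem_univ i))).resolve_right (sub_ne_zero.mpr (h i).symm)

theorem Matrix.IsHermitian.trace_mul_self_eq_sum_eigenvalues_sq {m : Type*} [Fintype m]
    [DecidableEq m] {A : Matrix m m ℂ} (hA : A.IsHermitian) :
    (A * A).trace = ((∑ i, hA.eigenvalues i ^ 2 : ℝ) : ℂ) := by
  conv_lhs => rw [hA.spectral_theorem]
  rw [← map_mul, Unitary.conjStarAlgAut_apply, Matrix.trace_mul_cycle,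
    Unitary.coe_star_mul_self, one_mul, Matrix.diagonal_mul_diagonal, Matrix.trace_diagonal]
  simp [sq]

variable {m n : Type*} [Fintype m] [Fintype n]

/-- The sum of the squared moduli of all `2 × 2` minors of a matrix. -/
noncomputable def minorSum (M : Matrix m n ℂ) : ℝ :=
  ∑ a, ∑ a', ∑ b, ∑ b', ‖M a b * M a' b' - M a b' * M a' b‖ ^ 2

theorem minorSum_eq_trace (M : Matrix m n ℂ) :
    (minorSum M : ℂ) = 2 * (M * Mᴴ).trace ^ 2 - 2 * (M * Mᴴ * (M * Mᴴ)).trace := by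
  have h1 : (M * Mᴴ).trace ^ 2 =
      ∑ a, ∑ a', ∑ b, ∑ b', M a b * star (M a b) * (M a' b' * star (M a' b')) := by
    simp only [sq, Matrix.trace, Matrix.diag_apply, Matrix.mul_apply, Matrix.conjTranspose_apply,
      Finset.sum_mul_sum]
  have h1' : (M * Mᴴ).trace ^ 2 =
      ∑ a, ∑ a', ∑ b, ∑ b', M a b' * star (M a b') * (M a' b * star (M a' b)) := by
    rw [h1]
    refine Finset.sum_congr rfl fun a _ => Finset.sum_congr rfl fun a' _ => ?_
    rw [Finset.sum_comm]
  have h2 : (M * Mᴴ * (M * Mᴴ)).trace =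
      ∑ a, ∑ a', ∑ b, ∑ b', M a b * star (M a' b) * (M a' b' * star (M a b')) := by
    simp only [Matrix.trace, Matrix.diag_apply, Matrix.mul_apply, Matrix.conjTranspose_apply,
      Finset.sum_mul_sum]
  have h2' : (M * Mᴴ * (M * Mᴴ)).trace =
      ∑ a, ∑ a', ∑ b, ∑ b', M a b' * star (M a' b') * (M a' b * star (M a b)) := by
    rw [h2]
    refine Finset.sum_congr rfl fun a _ => Finset.sum_congr rfl fun a' _ => ?_
    rw [Finset.sum_comm]
  rw [two_mul, two_mul]
  nth_rewrite 1 [h1]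
  nth_rewrite 1 [h1', h2]
  rw [h2', minorSum]
  push_cast
  simp only [← Finset.sum_add_distrib, ← Finset.sum_sub_distrib]
  refine Finset.sum_congr rfl fun a _ => Finset.sum_congr rfl fun a' _ =>
    Finset.sum_congr rfl fun b _ => Finset.sum_congr rfl fun b' _ => ?_
  rw [← Complex.mul_conj']
  simp only [map_sub, map_mul, RCLike.star_def]
  ring

theorem minorSum_eq_one_sub_sum_eigenvalues_sq [DecidableEq m] {M : Matrix m n ℂ}
    (h : (M * Mᴴ).IsHermitian) (htr : (M * Mᴴ).trace = 1) :
    minorSum M = 2 * (1 - ∑ i, h.eigenvalues i ^ 2) := by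
  have h1 := minorSum_eq_trace M
  rw [htr, h.trace_mul_self_eq_sum_eigenvalues_sq] at h1
  have h2 : (minorSum M : ℂ) = ((2 * (1 - ∑ i, h.eigenvalues i ^ 2) : ℝ) : ℂ) := by
    rw [h1]
    push_cast
    ring
  exact_mod_cast h2

theorem minorSum_nonneg (M : Matrix m n ℂ) : 0 ≤ minorSum M := by
  unfold minorSum
  positivity

theorem minorSum_eq_zero_iff {M : Matrix m n ℂ} :
    minorSum M = 0 ↔ ∃ (φ : m → ℂ) (χ : n → ℂ), ∀ a b, M a b = φ a * χ b := by
  constructor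
  · intro h
    have hminor : ∀ a a' b b', M a b * M a' b' = M a b' * M a' b := by
      intro a a' b b'
      unfold minorSum at h
      rw [Finset.sum_eq_zero_iff_of_nonneg fun _ _ => by positivity] at h
      have h := h a (Finset.mem_univ _)
      rw [Finset.sum_eq_zero_iff_of_nonneg fun _ _ => by positivity] at h
      have h := h a' (Finset.mem_univ _)
      rw [Finset.sum_eq_zero_iff_of_nonneg fun _ _ => by positivity] at h
      have h := h b (Finset.mem_univ _)
      rw [Finset.sum_eq_zero_iff_of_nonneg fun _ _ => by positivity] at h
      exact sub_eq_zero.mp (norm_eq_zero.mp (pow_eq_zero_iff two_ne_zero |>.mp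
        (h b' (Finset.mem_univ _))))
    by_cases h0 : ∃ a b, M a b ≠ 0
    · obtain ⟨a₀, b₀, h0⟩ := h0
      refine ⟨fun a => M a b₀, fun b => M a₀ b / M a₀ b₀, fun a b => ?_⟩
      rw [← mul_div_assoc, eq_div_iff h0, hminor a a₀ b b₀]
    · push Not at h0
      exact ⟨0, 0, fun a b => by simp [h0]⟩
  · rintro ⟨φ, χ, h⟩
    refine Finset.sum_eq_zero fun a _ => Finset.sum_eq_zero fun a' _ =>
      Finset.sum_eq_zero fun b _ => Finset.sum_eq_zero fun b' _ => ?_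
    have : M a b * M a' b' - M a b' * M a' b = 0 := by
      simp only [h]
      ring
    simp [this]

end Schmidt

section Multipartite

variable {N : ℕ} {dims : Fin N → ℕ}

/-- The coefficient matrix of `ψ` with respect to the bipartition `γ|γᶜ`. -/
def coeffMat (γ : Finset (Fin N)) (ψ : (∀ i, Fin (dims i)) → ℂ) :
    Matrix (∀ i : {i // i ∈ γ}, Fin (dims i.1)) (∀ i : {i // i ∈ γᶜ}, Fin (dims i.1)) ℂ :=
  Matrix.of fun a b => ψ (mergeIdx γ a b)

theorem reducedMat_eq (γ : Finset (Fin N)) (ψ : (∀ i, Fin (dims i)) → ℂ) :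
    reducedMat γ ψ = coeffMat γ ψ * (coeffMat γ ψ)ᴴ := rfl

theorem mergeIdx_bijective (γ : Finset (Fin N)) :
    Function.Bijective fun x : (∀ i : {i // i ∈ γ}, Fin (dims i.1)) ×
      (∀ i : {i // i ∈ γᶜ}, Fin (dims i.1)) => mergeIdx γ x.1 x.2 := by
  refine ⟨fun x y h => Prod.ext (funext fun i => ?_) (funext fun i => ?_), fun t => ?_⟩
  · simpa [mergeIdx, i.2] using congrFun h i.1
  · simpa [mergeIdx, Finset.mem_compl.mp i.2] using congrFun h i.1
  · refine ⟨(fun i => t i.1, fun i => t i.1), funext fun i => ?_⟩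
    simp [mergeIdx]

theorem trace_reducedMat (γ : Finset (Fin N)) {ψ : (∀ i, Fin (dims i)) → ℂ}
    (hψ : ψ ∈ pureStates (∀ i, Fin (dims i))) : (reducedMat γ ψ).trace = 1 := by
  have h : ((∑ t, ‖ψ t‖ ^ 2 : ℝ) : ℂ) = 1 := by
    rw [show ∑ t, ‖ψ t‖ ^ 2 = 1 from hψ, Complex.ofReal_one]
  rw [← h, ← (mergeIdx_bijective γ).sum_comp, Fintype.sum_prod_type]
  simp [Matrix.trace, reducedMat, Complex.mul_conj']

theorem continuous_minorSum_coeffMat (γ : Finset (Fin N)) :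
    Continuous fun ψ : (∀ i, Fin (dims i)) → ℂ => minorSum (coeffMat γ ψ) := by
  unfold minorSum coeffMat
  simp only [Matrix.of_apply]
  fun_prop

theorem pureBisep_iff {ψ : (∀ i, Fin (dims i)) → ℂ} :
    PureBisep ψ ↔ ∃ γ ∈ bips N, minorSum (coeffMat γ ψ) = 0 := by
  simp only [minorSum_eq_zero_iff]
  rfl

theorem isClosed_pureBisep : IsClosed {ψ : (∀ i, Fin (dims i)) → ℂ | PureBisep ψ} := by
  have h : {ψ : (∀ i, Fin (dims i)) → ℂ | PureBisep ψ} =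
      ⋃ γ ∈ bips N, {ψ | minorSum (coeffMat γ ψ) = 0} := by
    ext ψ
    simp [pureBisep_iff]
  rw [h]
  exact isClosed_biUnion_finset fun γ _ =>
    isClosed_eq (continuous_minorSum_coeffMat γ) continuous_const

variable {F : SymmConcave}

theorem exists_schmidtVal_eq (F : SymmConcave) (γ : Finset (Fin N))
    {ψ : (∀ i, Fin (dims i)) → ℂ} (hψ : ψ ∈ pureStates (∀ i, Fin (dims i))) :
    ∃ p : Fin (Fintype.card (∀ i : {i // i ∈ γ}, Fin (dims i.1))) → ℝ,
      schmidtVal F γ ψ = F.f _ p ∧ (∀ i, 0 ≤ p i) ∧ ∑ i, p i = 1 ∧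
        minorSum (coeffMat γ ψ) = 2 * (1 - ∑ i, p i ^ 2) := by
  classical
  have hpsd : (reducedMat γ ψ).PosSemidef := by
    rw [reducedMat_eq]
    exact Matrix.posSemidef_self_mul_conjTranspose _
  have htr := trace_reducedMat γ hψ
  rw [schmidtVal, dif_pos hpsd.1]
  refine ⟨_, rfl, fun i => hpsd.eigenvalues_nonneg _, ?_, ?_⟩
  · rw [Equiv.sum_comp (Fintype.equivFin _).symm hpsd.1.eigenvalues]
    have h := hpsd.1.trace_eq_sum_eigenvalues
    rw [htr] at h
    have h' : ((∑ i, hpsd.1.eigenvalues i : ℝ) : ℂ) = 1 := by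
      rw [h, Complex.ofReal_sum]
      rfl
    exact_mod_cast h'
  · rw [Equiv.sum_comp (Fintype.equivFin _).symm fun i => hpsd.1.eigenvalues i ^ 2]
    exact minorSum_eq_one_sub_sum_eigenvalues_sq hpsd.1 htr

theorem exists_mul_minorSum_le_schmidtVal (hF : F.IsPos) (γ : Finset (Fin N)) :
    ∃ c > 0, ∀ ψ ∈ pureStates (∀ i, Fin (dims i)),
      c * minorSum (coeffMat γ ψ) ≤ schmidtVal F γ ψ := by
  obtain ⟨c, hc, h⟩ := hF.exists_mul_le (Fintype.card (∀ i : {i // i ∈ γ}, Fin (dims i.1)))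
  refine ⟨c / 2, half_pos hc, fun ψ hψ => ?_⟩
  obtain ⟨p, hp, hp0, hp1, hm⟩ := exists_schmidtVal_eq F γ hψ
  rw [hp, hm]
  linarith [h p hp0 hp1]

theorem schmidtVal_nonneg (hF : F.IsPos) (γ : Finset (Fin N)) {ψ : (∀ i, Fin (dims i)) → ℂ}
    (hψ : ψ ∈ pureStates (∀ i, Fin (dims i))) : 0 ≤ schmidtVal F γ ψ := by
  obtain ⟨c, hc, h⟩ := exists_mul_minorSum_le_schmidtVal (dims := dims) hF γ
  exact (mul_nonneg hc.le (minorSum_nonneg _)).trans (h ψ hψ)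

theorem PureBisep.exists_schmidtVal_eq_zero (hF : F.IsPos) {ψ : (∀ i, Fin (dims i)) → ℂ}
    (hψ : ψ ∈ pureStates (∀ i, Fin (dims i))) (hB : PureBisep ψ) :
    ∃ γ ∈ bips N, schmidtVal F γ ψ = 0 := by
  obtain ⟨γ, hγ, h0⟩ := pureBisep_iff.mp hB
  refine ⟨γ, hγ, ?_⟩
  obtain ⟨p, hp, hp0, hp1, hm⟩ := exists_schmidtVal_eq F γ hψ
  rw [hp]
  exact hF.eq_zero hp0 hp1 (by linarith)

/-- On a compact set of pure states that are not biseparable, all Schmidt values are uniformly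
bounded away from zero. -/
theorem exists_pos_le_schmidtVal (hF : F.IsPos) {T : Set ((∀ i, Fin (dims i)) → ℂ)}
    (hT : IsCompact T) (hTB : T ⊆ pureStates (∀ i, Fin (dims i)) \ {ψ | PureBisep ψ}) :
    ∃ m > 0, ∀ ψ ∈ T, ∀ γ ∈ bips N, m ≤ schmidtVal F γ ψ := by
  have key : ∀ γ : bips N, ∃ m > 0, ∀ ψ ∈ T, m ≤ schmidtVal F γ ψ := by
    intro γ
    obtain ⟨c, hc, h⟩ := exists_mul_minorSum_le_schmidtVal (dims := dims) hF γ.1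
    obtain ⟨a, ha, haT⟩ := hT.exists_forall_le' (a := 0)
      (continuous_minorSum_coeffMat γ.1).continuousOn fun ψ hψ =>
        (minorSum_nonneg _).lt_of_ne' fun h0 =>
          (hTB hψ).2 (pureBisep_iff.mpr ⟨γ, γ.2, h0⟩)
    exact ⟨c * a, mul_pos hc ha, fun ψ hψ =>
      (mul_le_mul_of_nonneg_left (haT ψ hψ) hc.le).trans (h ψ (hTB hψ).1)⟩
  choose g hg hgT using key
  obtain ⟨m, hm, hmg⟩ := exists_pos_forall_le hg
  exact ⟨m, hm, fun ψ hψ γ hγ => (hmg ⟨γ, hγ⟩).trans (hgT ⟨γ, hγ⟩ ψ hψ)⟩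

theorem bips_nonempty (hN : 2 ≤ N) : (bips N).Nonempty := by
  refine ⟨{⟨0, by omega⟩}, Finset.mem_filter.mpr ⟨Finset.mem_univ _,
    Finset.singleton_nonempty _, fun h => ?_⟩⟩
  have h1 := congrArg Finset.card h
  rw [Finset.card_singleton, Finset.card_univ, Fintype.card_fin] at h1
  omega

end Multipartite

/-- For `f ∈ F⁺_sc` and an `N`-partite mixed state `ρ`, the convex-roof
min-GME measure vanishes iff `ρ` is biseparable, and likewise for the
convex-roof geo-GME measure. -/
theorem stmt_7 {N : ℕ} (hN : 2 ≤ N) (dims : Fin N → ℕ) (hdims : ∀ i, 1 ≤ dims i)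
    (F : SymmConcave) (hF : F.IsPos)
    (ρ : Matrix (∀ i, Fin (dims i)) (∀ i, Fin (dims i)) ℂ)
    (hρ : ρ.PosSemidef) (htr : ρ.trace = 1) :
    (convexRoof (EGMEp F) ρ = 0 ↔ MixedBisep ρ) ∧
    (convexRoof (GGMEp F) ρ = 0 ↔ MixedBisep ρ) := by
  obtain ⟨γ₀, hγ₀⟩ := bips_nonempty hN
  have hcard : (bips N).card ≠ 0 := Finset.card_ne_zero_of_mem hγ₀
  refine ⟨convexRoof_eq_zero_iff isClosed_pureBisep (fun ψ hψ => ?_) (fun ψ hψ => ?_)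
      (fun T hT hTB => ?_) hρ htr,
    convexRoof_eq_zero_iff isClosed_pureBisep (fun ψ hψ => ?_) (fun ψ hψ => ?_)
      (fun T hT hTB => ?_) hρ htr⟩
  · refine Real.sInf_nonneg ?_
    rintro x ⟨γ, -, rfl⟩
    exact schmidtVal_nonneg hF γ hψ
  · obtain ⟨γ, hγ, h0⟩ := PureBisep.exists_schmidtVal_eq_zero hF hψ.1 hψ.2
    have hlow : ∀ x ∈ {x | ∃ γ ∈ bips N, x = schmidtVal F γ ψ}, 0 ≤ x := by
      rintro x ⟨γ, -, rfl⟩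
      exact schmidtVal_nonneg hF γ hψ.1
    exact le_antisymm (csInf_le ⟨0, hlow⟩ ⟨γ, hγ, h0.symm⟩) (Real.sInf_nonneg hlow)
  · obtain ⟨m, hm, h⟩ := exists_pos_le_schmidtVal hF hT hTB
    refine ⟨m, hm, fun ψ hψ => le_csInf ⟨_, γ₀, hγ₀, rfl⟩ ?_⟩
    rintro x ⟨γ, hγ, rfl⟩
    exact h ψ hψ γ hγ
  · exact Real.rpow_nonneg (Finset.prod_nonneg fun γ _ => schmidtVal_nonneg hF γ hψ) _
  · obtain ⟨γ, hγ, h0⟩ := PureBisep.exists_schmidtVal_eq_zero hF hψ.1 hψ.2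
    rw [GGMEp, Finset.prod_eq_zero hγ h0, Real.zero_rpow (inv_ne_zero (Nat.cast_ne_zero.mpr hcard))]
  · obtain ⟨m, hm, h⟩ := exists_pos_le_schmidtVal hF hT hTB
    refine ⟨m, hm, fun ψ hψ => ?_⟩
    rw [← Real.pow_rpow_inv_natCast hm.le hcard, GGMEp]
    refine Real.rpow_le_rpow (pow_nonneg hm.le _) ?_ (by positivity)
    rw [← Finset.prod_const]
    exact Finset.prod_le_prod (fun _ _ => hm.le) fun γ hγ => h ψ hψ γ hγ
end

section
/- (Proposition 2) Let N ≥ 2, let ρ be any single-qubit state with entries ρ_{ij}, and let ρ' = Σ_{i,j∈{0,1}} ρ_{ij}|i⟩^{⊗N}⟨j|^{⊗N} on (ℂ²)^{⊗N}. Then the geometric mean of bipartite concurrence satisfies GBC(ρ') = K_N · C_{l₁}(ρ), where K_N = [∏_{γ} (d_γ/(2(d_γ − 1)))^{1/2}]^{1/c(N)} is a constant depending only on N, the product running over all c(N) bipartitions γ|γ̄ of {1,…,N}, with d_γ = 2^{min(|γ|, N−|γ|)} the dimension of the smaller subsystem of the bipartition. -/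
open scoped BigOperators
open Matrix
open scoped ComplexOrder

/-- The bipartite concurrence `√(2(1 - Tr ρ_γ²))` of a pure state across the
bipartition `γ|γ̄`. -/
noncomputable def bipConc {N : ℕ} {dims : Fin N → ℕ} (γ : Finset (Fin N))
    (ψ : (∀ i, Fin (dims i)) → ℂ) : ℝ :=
  Real.sqrt (2 * (1 - ((reducedMat γ ψ * reducedMat γ ψ).trace).re))

/-- The GME-concurrence of a pure state: the minimum of the bipartite
concurrence over all bipartitions. -/
noncomputable def gmeConcPure {N : ℕ} {dims : Fin N → ℕ}
    (ψ : (∀ i, Fin (dims i)) → ℂ) : ℝ :=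
  sInf {x | ∃ γ ∈ bips N, x = bipConc γ ψ}

/-- The `l₁`-norm of coherence: the sum of the absolute values of the
off-diagonal entries. -/
noncomputable def Cl1 {d : ℕ} (ρ : Matrix (Fin d) (Fin d) ℂ) : ℝ :=
  ∑ i, ∑ j, if i = j then 0 else ‖ρ i j‖

/-- The dimension `d_γ = 2^{min(|γ|, N−|γ|)}` of the smaller subsystem of the
bipartition `γ|γ̄` of an `N`-qubit system, as a real number. -/
def dSmall (N : ℕ) (γ : Finset (Fin N)) : ℝ := 2 ^ min γ.card (N - γ.card)

/-- `E_γ(Φ) = √((d_γ/(d_γ−1))(1 − Tr ρ_γ²))` for a pure `N`-qubit state. -/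
noncomputable def gbcE {N : ℕ} (γ : Finset (Fin N))
    (Φ : (∀ _ : Fin N, Fin 2) → ℂ) : ℝ :=
  Real.sqrt ((dSmall N γ / (dSmall N γ - 1)) *
    (1 - ((reducedMat (dims := fun _ : Fin N => 2) γ Φ *
           reducedMat (dims := fun _ : Fin N => 2) γ Φ).trace).re))

/-- The geometric mean of bipartite concurrence (GBC) of a pure `N`-qubit
state: the geometric mean of `E_γ` over all bipartitions. -/
noncomputable def GBCpure {N : ℕ} (Φ : (∀ _ : Fin N, Fin 2) → ℂ) : ℝ :=
  (∏ γ ∈ bips N, gbcE γ Φ) ^ (((bips N).card : ℝ))⁻¹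

/-- The GHZ-type vector `u₀|0…0⟩ + u₁|1…1⟩`. -/
noncomputable def ghz {ι : Type*} [Fintype ι] (u : Fin 2 → ℂ) (t : ι → Fin 2) : ℂ :=
  (if t = fun _ => 0 then u 0 else 0) + (if t = fun _ => 1 then u 1 else 0)

lemma const_zero_ne_one {ι : Type*} [Nonempty ι] :
    (fun _ : ι => (0 : Fin 2)) ≠ fun _ => 1 := fun h =>
  absurd (congrFun h (Classical.arbitrary ι)) (by decide)

lemma sum_norm_sq_ghz {ι : Type*} [Fintype ι] [DecidableEq ι] [Nonempty ι] (u : Fin 2 → ℂ) :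
    ∑ t : ι → Fin 2, ‖ghz u t‖ ^ 2 = ‖u 0‖ ^ 2 + ‖u 1‖ ^ 2 := by
  have h : ∀ t : ι → Fin 2, ‖ghz u t‖ ^ 2 =
      (if t = fun _ => 0 then ‖u 0‖ ^ 2 else 0) + (if t = fun _ => 1 then ‖u 1‖ ^ 2 else 0) := by
    intro t
    have := const_zero_ne_one (ι := ι)
    by_cases h0 : t = fun _ => 0
    · subst h0; simp [ghz, this]
    · by_cases h1 : t = fun _ => 1
      · subst h1; simp [ghz, this.symm]
      · simp [ghz, h0, h1]
  simp [h, Finset.sum_add_distrib]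

lemma mergeIdx_eq_const_iff {N : ℕ} (γ : Finset (Fin N)) (a : {i // i ∈ γ} → Fin 2)
    (b : {i // i ∈ γᶜ} → Fin 2) (s : Fin 2) :
    (mergeIdx (dims := fun _ => 2) γ a b = fun _ => s) ↔
      (a = fun _ => s) ∧ (b = fun _ => s) := by
  constructor
  · intro h
    constructor
    · funext i
      simpa [mergeIdx, i.2] using congrFun h i.1
    · funext i
      have hi : i.1 ∉ γ := Finset.mem_compl.mp i.2
      simpa [mergeIdx, hi] using congrFun h i.1
  · rintro ⟨rfl, rfl⟩
    funext i
    simp [mergeIdx]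

lemma reducedMat_ghz {N : ℕ} {γ : Finset (Fin N)} (hγ : γ.Nonempty) (hγ' : γ ≠ Finset.univ)
    (u : Fin 2 → ℂ) :
    reducedMat (dims := fun _ => 2) γ (ghz u) = Matrix.diagonal fun a =>
      (if a = fun _ => 0 then ((‖u 0‖ ^ 2 : ℝ) : ℂ) else 0) +
        (if a = fun _ => 1 then ((‖u 1‖ ^ 2 : ℝ) : ℂ) else 0) := by
  have : Nonempty {i // i ∈ γ} := hγ.to_subtype
  have : Nonempty {i // i ∈ γᶜ} :=
    (Finset.nonempty_iff_ne_empty.mpr (by simpa using hγ')).to_subtype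
  have hne := const_zero_ne_one (ι := {i // i ∈ γ})
  have hne' := const_zero_ne_one (ι := {i // i ∈ γᶜ})
  ext a a'
  have hterm : ∀ b : {i // i ∈ γᶜ} → Fin 2,
      ghz u (mergeIdx (dims := fun _ => 2) γ a b) *
        star (ghz u (mergeIdx (dims := fun _ => 2) γ a' b)) =
      (if b = fun _ => 0 then
        (if a = fun _ => 0 then u 0 else 0) * star (if a' = fun _ => 0 then u 0 else 0) else 0) +
      (if b = fun _ => 1 then
        (if a = fun _ => 1 then u 1 else 0) * star (if a' = fun _ => 1 then u 1 else 0) else 0) := by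
    intro b
    simp only [ghz, mergeIdx_eq_const_iff]
    by_cases h0 : b = fun _ => 0
    · subst h0; simp [hne']
    · by_cases h1 : b = fun _ => 1
      · subst h1; simp [hne'.symm]
      · simp [h0, h1]
  simp only [reducedMat, Matrix.of_apply, hterm, Finset.sum_add_distrib, Finset.sum_ite_eq',
    Finset.mem_univ, if_true, Matrix.diagonal_apply]
  have hu : ∀ z : ℂ, z * star z = ((‖z‖ ^ 2 : ℝ) : ℂ) := by
    intro z; simpa using Complex.mul_conj' z
  by_cases haa : a = a'
  · subst haa
    by_cases h0 : a = fun _ => 0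
    · subst h0; simpa [hne] using hu (u 0)
    · by_cases h1 : a = fun _ => 1
      · subst h1; simpa [hne.symm] using hu (u 1)
      · simp [h0, h1]
  · rw [if_neg haa]
    by_cases h0 : a = fun _ => 0
    · subst h0; simp [hne, Ne.symm haa]
    · by_cases h1 : a = fun _ => 1
      · subst h1; simp [hne.symm, Ne.symm haa]
      · simp [h0, h1]

lemma purity_reducedMat_ghz {N : ℕ} {γ : Finset (Fin N)} (hγ : γ.Nonempty)
    (hγ' : γ ≠ Finset.univ) (u : Fin 2 → ℂ) :
    ((reducedMat (dims := fun _ => 2) γ (ghz u) *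
      reducedMat (dims := fun _ => 2) γ (ghz u)).trace).re = ‖u 0‖ ^ 4 + ‖u 1‖ ^ 4 := by
  have : Nonempty {i // i ∈ γ} := hγ.to_subtype
  have hne := const_zero_ne_one (ι := {i // i ∈ γ})
  have hsq : ∀ (a : {i // i ∈ γ} → Fin 2) (x y : ℂ),
      ((if a = fun _ => 0 then x else 0) + (if a = fun _ => 1 then y else 0)) *
        ((if a = fun _ => 0 then x else 0) + (if a = fun _ => 1 then y else 0)) =
      (if a = fun _ => 0 then x * x else 0) + (if a = fun _ => 1 then y * y else 0) := by
    intro a x y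
    by_cases h0 : a = fun _ => 0
    · subst h0; simp [hne]
    · by_cases h1 : a = fun _ => 1
      · subst h1; simp [hne.symm]
      · simp [h0, h1]
  rw [reducedMat_ghz hγ hγ', Matrix.diagonal_mul_diagonal, Matrix.trace_diagonal]
  simp only [hsq, Finset.sum_add_distrib, Finset.sum_ite_eq', Finset.mem_univ, if_true]
  norm_cast
  ring

lemma gbcE_ghz {N : ℕ} {γ : Finset (Fin N)} (hγ : γ.Nonempty) (hγ' : γ ≠ Finset.univ)
    {u : Fin 2 → ℂ} (hu : ‖u 0‖ ^ 2 + ‖u 1‖ ^ 2 = 1) :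
    gbcE γ (ghz u) =
      Real.sqrt (dSmall N γ / (2 * (dSmall N γ - 1))) * (2 * ‖u 0 * u 1‖) := by
  rw [gbcE, purity_reducedMat_ghz hγ hγ', norm_mul]
  have h : 1 - (‖u 0‖ ^ 4 + ‖u 1‖ ^ 4) = (2 * (‖u 0‖ * ‖u 1‖)) ^ 2 / 2 := by
    linear_combination (-(‖u 0‖ ^ 2 + ‖u 1‖ ^ 2) - 1) * hu
  have h' : dSmall N γ / (dSmall N γ - 1) * ((2 * (‖u 0‖ * ‖u 1‖)) ^ 2 / 2) =
      dSmall N γ / (2 * (dSmall N γ - 1)) * (2 * (‖u 0‖ * ‖u 1‖)) ^ 2 := by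
    rw [div_mul_div_comm, div_mul_eq_mul_div, mul_comm (dSmall N γ - 1) 2]
  rw [h, h', Real.sqrt_mul' _ (sq_nonneg _), Real.sqrt_sq (by positivity)]

lemma card_bips_ne_zero {N : ℕ} (hN : 2 ≤ N) : (bips N).card ≠ 0 := by
  refine Finset.card_ne_zero.mpr ⟨{⟨0, by omega⟩}, ?_⟩
  simp only [bips, Finset.mem_filter, Finset.mem_univ, true_and, Finset.singleton_nonempty]
  intro h
  have := congrArg Finset.card h
  simp at this
  omega

lemma GBCpure_ghz {N : ℕ} (hN : 2 ≤ N) {u : Fin 2 → ℂ} (hu : ‖u 0‖ ^ 2 + ‖u 1‖ ^ 2 = 1) :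
    GBCpure (N := N) (ghz u) =
      (∏ γ ∈ bips N, Real.sqrt (dSmall N γ / (2 * (dSmall N γ - 1)))) ^
        (((bips N).card : ℝ))⁻¹ * (2 * ‖u 0 * u 1‖) := by
  have h : ∀ γ ∈ bips N, gbcE γ (ghz u) =
      Real.sqrt (dSmall N γ / (2 * (dSmall N γ - 1))) * (2 * ‖u 0 * u 1‖) := by
    intro γ hγ
    simp only [bips, Finset.mem_filter, Finset.mem_univ, true_and] at hγ
    exact gbcE_ghz hγ.1 hγ.2 hu
  rw [GBCpure, Finset.prod_congr rfl h, Finset.prod_mul_distrib, Finset.prod_const,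
    Real.mul_rpow (Finset.prod_nonneg fun _ _ => Real.sqrt_nonneg _) (by positivity),
    Real.pow_rpow_inv_natCast (by positivity) (card_bips_ne_zero hN)]

/-- Outer products of GHZ-type vectors embed the outer product of the coefficient vectors. -/
lemma ghz_mul_star_ghz {N : ℕ} (i₀ : Fin N) (u : Fin 2 → ℂ) (t s : Fin N → Fin 2) :
    ghz u t * star (ghz u s) =
      if (∀ i, t i = t i₀) ∧ (∀ i, s i = s i₀) then u (t i₀) * star (u (s i₀)) else 0 := by
  have key : ∀ t : Fin N → Fin 2, ghz u t = if ∀ i, t i = t i₀ then u (t i₀) else 0 := by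
    intro t
    have : Nonempty (Fin N) := ⟨i₀⟩
    have hne := const_zero_ne_one (ι := Fin N)
    split_ifs with h
    · obtain ⟨x, rfl⟩ : ∃ x, t = fun _ => x := ⟨t i₀, funext h⟩
      fin_cases x
      · simp [ghz, hne]
      · simp [ghz, hne.symm]
    · have h' : ∀ x, t ≠ fun _ => x := by
        rintro x rfl
        exact h fun _ => rfl
      simp [ghz, h']
  rw [key, key]
  split_ifs <;> simp_all

lemma eq_ghz_of_forall_ne {ι : Type*} [Fintype ι] [Nonempty ι] {ψ : (ι → Fin 2) → ℂ}
    (h : ∀ t, (t ≠ fun _ => 0) → (t ≠ fun _ => 1) → ψ t = 0) :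
    ψ = ghz fun x => ψ fun _ => x := by
  have hne := const_zero_ne_one (ι := ι)
  funext t
  by_cases h0 : t = fun _ => 0
  · subst h0; simp [ghz, hne]
  · by_cases h1 : t = fun _ => 1
    · subst h1; simp [ghz, hne.symm]
    · simp [ghz, h0, h1, h t h0 h1]

/-- A qubit state has a pure-state decomposition attaining its `l₁`-norm coherence. -/
lemma exists_decomposition_sum_eq {ρ : Matrix (Fin 2) (Fin 2) ℂ} (hρ : ρ.PosSemidef)
    (htr : ρ.trace = 1) :
    ∃ (K : ℕ) (p : Fin K → ℝ) (u : Fin K → Fin 2 → ℂ), (∀ k, 0 < p k) ∧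
      (∀ k, ‖u k 0‖ ^ 2 + ‖u k 1‖ ^ 2 = 1) ∧
      (∀ i j, ρ i j = ∑ k, (p k : ℂ) * (u k i * star (u k j))) ∧
      ∑ k, p k * (2 * ‖u k 0 * u k 1‖) = 2 * ‖ρ 0 1‖ := by
  obtain ⟨a, ha, h00⟩ : ∃ a : ℝ, 0 ≤ a ∧ ρ 0 0 = a :=
    ⟨_, (Complex.nonneg_iff.mp (hρ.diag_nonneg (i := 0))).1,
      Complex.eq_re_of_ofReal_le (r := 0) (by simpa using hρ.diag_nonneg (i := 0))⟩
  have h11 : ρ 1 1 = ((1 - a : ℝ) : ℂ) := by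
    rw [Matrix.trace_fin_two, h00] at htr
    push_cast
    linear_combination htr
  have h10 : ρ 1 0 = star (ρ 0 1) := (hρ.isHermitian.apply 1 0).symm
  set b := ρ 0 1 with hb
  have hbb : b * star b = ((‖b‖ ^ 2 : ℝ) : ℂ) := by simpa using Complex.mul_conj' b
  have hdet : ‖b‖ ^ 2 ≤ a * (1 - a) := by
    have h := hρ.det_nonneg
    rw [Matrix.det_fin_two, h00, h11, h10, ← hb, hbb] at h
    norm_cast at h
    linarith
  rcases ha.eq_or_lt with rfl | hapos
  · have hb0 : b = 0 := by
      have : ‖b‖ ^ 2 = 0 := le_antisymm (by simpa using hdet) (sq_nonneg _)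
      simpa using this
    refine ⟨1, fun _ => 1, fun _ => ![0, 1], by simp, by simp, ?_, by simp [hb0]⟩
    intro i j
    fin_cases i <;> fin_cases j <;> simp [h00, h11, h10, ← hb, hb0]
  · set n : ℝ := a + ‖b‖ ^ 2 / a with hn
    have hnpos : 0 < n := by positivity
    set w : Fin 2 → ℂ := ![(√(a / n) : ℝ), star b / (√(a * n) : ℝ)] with hw
    have hsq : (√(a / n)) ^ 2 = a / n := Real.sq_sqrt (by positivity)
    have hsq' : (√(a * n)) ^ 2 = a * n := Real.sq_sqrt (by positivity)
    have hmul : n * √(a / n) = √(a * n) := by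
      rw [eq_comm, Real.sqrt_eq_iff_mul_self_eq (by positivity) (by positivity)]
      calc a * n = n ^ 2 * (√(a / n)) ^ 2 := by rw [hsq]; field_simp
        _ = n * √(a / n) * (n * √(a / n)) := by ring
    have hs : √(a * n) ≠ 0 := (Real.sqrt_pos.mpr (by positivity)).ne'
    have hsC : ((√(a * n) : ℝ) : ℂ) ≠ 0 := by exact_mod_cast hs
    have hunit : ‖w 0‖ ^ 2 + ‖w 1‖ ^ 2 = 1 := by
      simp only [hw, Matrix.cons_val_zero, Matrix.cons_val_one, norm_div, norm_star,
        Complex.norm_real, Real.norm_eq_abs, div_pow, sq_abs, hsq, hsq']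
      rw [hn] at hnpos ⊢
      field_simp
    have hmulC : (n : ℂ) * (√(a / n) : ℝ) = (√(a * n) : ℝ) := by exact_mod_cast hmul
    have hw00 : (n : ℂ) * (w 0 * star (w 0)) = a := by
      have : n * (√(a / n) * √(a / n)) = a := by rw [← sq, hsq]; field_simp
      simp only [hw, Matrix.cons_val_zero, Complex.star_def, Complex.conj_ofReal]
      exact_mod_cast this
    have hw01 : (n : ℂ) * (w 0 * star (w 1)) = b := by
      simp only [hw, Matrix.cons_val_zero, Matrix.cons_val_one, star_div₀,
        Complex.star_def, Complex.conj_ofReal, Complex.conj_conj]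
      rw [← mul_assoc, hmulC, mul_div_cancel₀ _ hsC]
    have hw10 : (n : ℂ) * (w 1 * star (w 0)) = star b := by
      rw [← hw01]
      simp [mul_comm]
    have hw11 : (n : ℂ) * (w 1 * star (w 1)) = ((‖b‖ ^ 2 / a : ℝ) : ℂ) := by
      have h : w 1 * star (w 1) = ((‖w 1‖ ^ 2 : ℝ) : ℂ) := by
        simpa using Complex.mul_conj' (w 1)
      have h' : n * ‖w 1‖ ^ 2 = ‖b‖ ^ 2 / a := by
        simp only [hw, Matrix.cons_val_one, Matrix.cons_val_zero, norm_div, norm_star,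
          Complex.norm_real, Real.norm_eq_abs, div_pow, sq_abs, hsq']
        field_simp
      rw [h]
      exact_mod_cast h'
    have hval : n * (2 * ‖w 0 * w 1‖) = 2 * ‖b‖ := by
      rw [← hw01]
      simp only [norm_mul, norm_star, Complex.norm_real, Real.norm_eq_abs, abs_of_pos hnpos]
      ring
    have hres : 0 ≤ 1 - a - ‖b‖ ^ 2 / a := by
      rw [sub_nonneg, div_le_iff₀ hapos]
      linarith
    rcases hres.eq_or_lt with hres | hres
    · refine ⟨1, fun _ => n, fun _ => w, fun _ => hnpos, fun _ => hunit, ?_, by simpa using hval⟩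
      intro i j
      rw [Fin.sum_univ_one]
      fin_cases i <;> fin_cases j
      · exact h00.trans hw00.symm
      · exact hw01.symm
      · exact h10.trans hw10.symm
      · refine h11.trans (Eq.trans ?_ hw11.symm)
        rw [sub_eq_zero.mp hres.symm]
    · refine ⟨2, ![n, 1 - a - ‖b‖ ^ 2 / a], ![w, ![0, 1]], ?_, ?_, ?_, ?_⟩
      · exact Fin.forall_fin_two.mpr ⟨hnpos, hres⟩
      · exact Fin.forall_fin_two.mpr ⟨hunit, by simp⟩
      · intro i j
        rw [Fin.sum_univ_two]
        simp only [Matrix.cons_val_zero, Matrix.cons_val_one]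
        fin_cases i <;> fin_cases j
        · simpa using h00.trans hw00.symm
        · simpa using hw01.symm
        · simpa using h10.trans hw10.symm
        · change ρ 1 1 = (n : ℂ) * (w 1 * star (w 1)) + _
          rw [hw11, h11]
          simp
      · simpa [Fin.sum_univ_two] using hval

lemma Cl1_eq_two_mul {ρ : Matrix (Fin 2) (Fin 2) ℂ} (hρ : ρ.IsHermitian) :
    Cl1 ρ = 2 * ‖ρ 0 1‖ := by
  have h : ‖ρ 1 0‖ = ‖ρ 0 1‖ := by rw [← hρ.apply 1 0, norm_star]
  simp [Cl1, Fin.sum_univ_two, h]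
  ring

/-- Proposition 2: for any single-qubit state `ρ` and
`ρ' = ∑_{i,j} ρ_{ij}|i⟩^{⊗N}⟨j|^{⊗N}`, the (convex-roof) GBC of `ρ'` equals the
constant `K_N = [∏_γ (d_γ/(2(d_γ−1)))^{1/2}]^{1/c(N)}` times the `l₁`-norm
coherence of `ρ`. -/
theorem stmt_13 (N : ℕ) (hN : 2 ≤ N)
    (ρ : Matrix (Fin 2) (Fin 2) ℂ) (hρ : ρ.PosSemidef) (htr : ρ.trace = 1) :
    let i₀ : Fin N := ⟨0, by omega⟩
    let ρ' : Matrix (∀ _ : Fin N, Fin 2) (∀ _ : Fin N, Fin 2) ℂ :=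
      Matrix.of fun t s =>
        if (∀ i, t i = t i₀) ∧ (∀ i, s i = s i₀) then ρ (t i₀) (s i₀) else 0
    let K : ℝ := (∏ γ ∈ bips N, Real.sqrt (dSmall N γ / (2 * (dSmall N γ - 1)))) ^
      (((bips N).card : ℝ))⁻¹
    convexRoof GBCpure ρ' = K * Cl1 ρ := by
  intro i₀ ρ' K
  have : Nonempty (Fin N) := ⟨i₀⟩
  have hK : 0 ≤ K := Real.rpow_nonneg (Finset.prod_nonneg fun _ _ => Real.sqrt_nonneg _) _
  rw [Cl1_eq_two_mul hρ.isHermitian]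
  refine IsLeast.csInf_eq ⟨?_, ?_⟩
  · obtain ⟨n, p, u, hp, hu, hdec, hsum⟩ := exists_decomposition_sum_eq hρ htr
    refine ⟨n, p, fun k => ghz (u k), hp, fun k => by rw [sum_norm_sq_ghz, hu], ?_, ?_⟩
    · ext t s
      simp only [ρ', Matrix.of_apply, Matrix.sum_apply, ghz_mul_star_ghz i₀]
      split_ifs
      · exact hdec _ _
      · simp
    · rw [← hsum, Finset.mul_sum]
      refine Finset.sum_congr rfl fun k _ => ?_
      rw [GBCpure_ghz hN (hu k)]
      ring
  · rintro x ⟨n, p, ψ, hp, hψ, hdec, rfl⟩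
    have hentry : ∀ t s, ρ' t s = ∑ k, (p k : ℂ) * (ψ k t * star (ψ k s)) := by
      intro t s
      rw [hdec]
      simp [Matrix.sum_apply]
    have hsupp : ∀ k, ∀ t, (t ≠ fun _ => 0) → (t ≠ fun _ => 1) → ψ k t = 0 := by
      intro k t h0 h1
      have hdiag : ρ' t t = 0 := by
        have : ¬ ∀ i, t i = t i₀ := by
          intro h
          rcases Fin.exists_fin_two.mp ⟨t i₀, rfl⟩ with h' | h'
          · exact h0 (funext fun i => (h i).trans h')
          · exact h1 (funext fun i => (h i).trans h')
        simp [ρ', this]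
      have hz : ∑ k, p k * ‖ψ k t‖ ^ 2 = 0 := by
        have h := (hentry t t).symm.trans hdiag
        have hc : ∀ z : ℂ, z * star z = ((‖z‖ ^ 2 : ℝ) : ℂ) := fun z => by
          simpa using Complex.mul_conj' z
        simp only [hc] at h
        exact_mod_cast h
      have := (Finset.sum_eq_zero_iff_of_nonneg
        fun k _ => mul_nonneg (hp k).le (sq_nonneg ‖ψ k t‖)).mp hz k (Finset.mem_univ k)
      simpa [(hp k).ne'] using this
    have hghz := fun k => eq_ghz_of_forall_ne (hsupp k)
    have hval : ∀ k, GBCpure (ψ k) = K * (2 * ‖ψ k (fun _ => 0) * ψ k (fun _ => 1)‖) := by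
      intro k
      have hn := hψ k
      rw [hghz k, sum_norm_sq_ghz] at hn
      conv_lhs => rw [hghz k]
      exact GBCpure_ghz hN hn
    have hρ01 : ρ 0 1 = ∑ k, (p k : ℂ) * (ψ k (fun _ => 0) * star (ψ k fun _ => 1)) := by
      rw [← hentry]
      simp [ρ']
    calc K * (2 * ‖ρ 0 1‖)
        ≤ K * (2 * ∑ k, p k * ‖ψ k (fun _ => 0) * ψ k (fun _ => 1)‖) := by
          gcongr
          rw [hρ01]
          refine (norm_sum_le _ _).trans_eq (Finset.sum_congr rfl fun k _ => ?_)
          simp [abs_of_pos (hp k)]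
      _ = ∑ k, p k * GBCpure (ψ k) := by
          rw [Finset.mul_sum, Finset.mul_sum]
          refine Finset.sum_congr rfl fun k _ => ?_
          rw [hval]
          ring
end

section
/- Define, for p, r, θ₁, θ₂, θ₃, θ₄ ∈ ℝ, H(θ₁,θ₂,θ₃,θ₄; p, r) = (p−1)sin²θ₃[2cos²θ₂cos²θ₄ + (sin²θ₂ − sin²θ₁)sin²θ₃ + 2sin²θ₁sin²θ₄] + p·cos²θ₃[cos²θ₁(cos²θ₃ − 2cos²θ₄) − cos²θ₂cos²θ₃ − 2sin²θ₂sin²θ₄] + r·sin(2θ₃)[cosθ₁ sinθ₁(cosθ₃ sinθ₃ − sin(2θ₄)) − cosθ₂ sinθ₂(cosθ₃ sinθ₃ + sin(2θ₄))]. Then for every p ∈ [0,1] and r with 0 ≤ r ≤ √(p(1−p)), the supremum of H over θ₁, θ₂, θ₃, θ₄ ∈ [0,π] is strictly positive if and only if r > 0. (Equivalently: if r = 0 then H ≤ 0 for all angles, and if r > 0 then there exist angles with H > 0.) -/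
open Real

/-- The Hardy-type Bell value `H(θ₁,θ₂,θ₃,θ₄; p, r)` for the special three-qubit
X-state `ρ' = p|000⟩⟨000| + r(|000⟩⟨111| + |111⟩⟨000|) + (1−p)|111⟩⟨111|`. -/
noncomputable def hardyH (θ₁ θ₂ θ₃ θ₄ p r : ℝ) : ℝ :=
  (p - 1) * sin θ₃ ^ 2 *
      (2 * cos θ₂ ^ 2 * cos θ₄ ^ 2 + (sin θ₂ ^ 2 - sin θ₁ ^ 2) * sin θ₃ ^ 2 +
        2 * sin θ₁ ^ 2 * sin θ₄ ^ 2) +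
    p * cos θ₃ ^ 2 *
      (cos θ₁ ^ 2 * (cos θ₃ ^ 2 - 2 * cos θ₄ ^ 2) - cos θ₂ ^ 2 * cos θ₃ ^ 2 -
        2 * sin θ₂ ^ 2 * sin θ₄ ^ 2) +
    r * sin (2 * θ₃) *
      (cos θ₁ * sin θ₁ * (cos θ₃ * sin θ₃ - sin (2 * θ₄)) -
        cos θ₂ * sin θ₂ * (cos θ₃ * sin θ₃ + sin (2 * θ₄)))

/-- On the unit cube, `z (x - y) ≤ 2 (1 - y) (1 - w) + 2 x w`. -/
lemma mul_sub_le_of_mem_unit {x y z w : ℝ} (hx0 : 0 ≤ x) (hx1 : x ≤ 1) (hy0 : 0 ≤ y)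
    (hy1 : y ≤ 1) (hz0 : 0 ≤ z) (hz1 : z ≤ 1) (hw0 : 0 ≤ w) (hw1 : w ≤ 1) :
    z * (x - y) ≤ 2 * ((1 - y) * (1 - w)) + 2 * (x * w) := by
  have h₁ : 0 ≤ (1 - y) * (1 - w) := mul_nonneg (by linarith) (by linarith)
  have h₂ : 0 ≤ x * w := mul_nonneg hx0 hw0
  rcases le_total x y with h | h
  · have h₃ : z * (x - y) ≤ 0 := mul_nonpos_of_nonneg_of_nonpos hz0 (by linarith)
    linarith
  · have h₃ : z * (x - y) ≤ x - y := mul_le_of_le_one_left (by linarith) hz1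
    have h₄ : 0 ≤ (1 - x) * (1 - w) := mul_nonneg (by linarith) (by linarith)
    have h₅ : 0 ≤ y * w := mul_nonneg hy0 hw0
    nlinarith

/-- Without coherence (`r = 0`) the Hardy-type Bell value is never positive. -/
lemma hardyH_zero_nonpos (θ₁ θ₂ θ₃ θ₄ : ℝ) {p : ℝ} (hp0 : 0 ≤ p) (hp1 : p ≤ 1) :
    hardyH θ₁ θ₂ θ₃ θ₄ p 0 ≤ 0 := by
  have hs := mul_sub_le_of_mem_unit (sq_nonneg (sin θ₁)) (sin_sq_le_one θ₁)
    (sq_nonneg (sin θ₂)) (sin_sq_le_one θ₂) (sq_nonneg (sin θ₃)) (sin_sq_le_one θ₃)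
    (sq_nonneg (sin θ₄)) (sin_sq_le_one θ₄)
  have hc := mul_sub_le_of_mem_unit (sq_nonneg (cos θ₁)) (cos_sq_le_one θ₁)
    (sq_nonneg (cos θ₂)) (cos_sq_le_one θ₂) (sq_nonneg (cos θ₃)) (cos_sq_le_one θ₃)
    (sq_nonneg (cos θ₄)) (cos_sq_le_one θ₄)
  rw [← cos_sq', ← cos_sq'] at hs
  rw [← sin_sq, ← sin_sq] at hc
  have h₁ := mul_nonneg (mul_nonneg (sub_nonneg.2 hp1) (sq_nonneg (sin θ₃))) (sub_nonneg.2 hs)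
  have h₂ := mul_nonneg (mul_nonneg hp0 (sq_nonneg (cos θ₃))) (sub_nonneg.2 hc)
  unfold hardyH
  linarith

/-- The Hardy-type Bell value on the family `θ₂ = 0`, `θ₃ = π / 4`, `θ₄ = π / 2`. -/
lemma hardyH_zero_pi_div_four_pi_div_two (θ p r : ℝ) :
    hardyH θ 0 (π / 4) (π / 2) p r =
      sin θ * (r / 2 * cos θ - (3 - 2 * p) / 4 * sin θ) := by
  have h₃ : 2 * (π / 4) = π / 2 := by ring
  have h₄ : 2 * (π / 2) = π := by ring
  have hq : √2 ^ 2 = (2 : ℝ) := sq_sqrt (by norm_num)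
  have hq2 : (√2 / 2) ^ 2 = (1 / 2 : ℝ) := by rw [div_pow, hq]; norm_num
  have hq3 : √2 / 2 * (√2 / 2) = (1 / 2 : ℝ) := by rw [← sq, hq2]
  unfold hardyH
  rw [h₃, h₄, sin_pi_div_four, cos_pi_div_four, hq2, hq3]
  simp only [sin_zero, cos_zero, sin_pi_div_two, cos_pi_div_two, sin_pi, cos_sq' θ]
  ring

/-- For `p ∈ [0,1]` and `0 ≤ r ≤ √(p(1−p))`, the Hardy-type Bell expression `H`
attains a strictly positive value for some angles in `[0, π]` if and only if
`r > 0`. -/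
theorem stmt_15 (p r : ℝ) (hp : p ∈ Set.Icc (0 : ℝ) 1)
    (hr0 : 0 ≤ r) (hr1 : r ≤ Real.sqrt (p * (1 - p))) :
    (∃ θ₁ ∈ Set.Icc (0 : ℝ) π, ∃ θ₂ ∈ Set.Icc (0 : ℝ) π, ∃ θ₃ ∈ Set.Icc (0 : ℝ) π,
      ∃ θ₄ ∈ Set.Icc (0 : ℝ) π, 0 < hardyH θ₁ θ₂ θ₃ θ₄ p r) ↔ 0 < r := by
  obtain ⟨hp0, hp1⟩ := hp
  have hπ := pi_pos
  constructor
  · rintro ⟨θ₁, -, θ₂, -, θ₃, -, θ₄, -, h⟩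
    refine hr0.lt_of_ne ?_
    rintro rfl
    exact h.not_ge (hardyH_zero_nonpos θ₁ θ₂ θ₃ θ₄ hp0 hp1)
  · intro hr
    have hθ0 : 0 < arctan (r / 2) := arctan_pos.2 (by linarith)
    have hθ1 := arctan_lt_pi_div_two (r / 2)
    refine ⟨arctan (r / 2), ⟨hθ0.le, by linarith⟩, 0, ⟨le_rfl, hπ.le⟩,
      π / 4, ⟨by linarith, by linarith⟩, π / 2, ⟨by linarith, by linarith⟩, ?_⟩
    have hsin : 0 < sin (arctan (r / 2)) := sin_pos_of_pos_of_lt_pi hθ0 (by linarith)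
    have htan : r / 2 * cos (arctan (r / 2)) = sin (arctan (r / 2)) := by
      have h := tan_mul_cos (cos_arctan_pos (r / 2)).ne'
      rwa [tan_arctan] at h
    rw [hardyH_zero_pi_div_four_pi_div_two, htan]
    refine mul_pos hsin ?_
    nlinarith
end
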